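/- arXiv:0710.3637 — 2 statements merged into one kernel-verified Lean document; each statement's English description precedes it below -/
import Mathlib

section
/- (Proposition 3.1) Let n ≥ 2 and let f be a C^∞ strictly convex function on a domain in ℝⁿ satisfying equation (1.3). Then at every point where Φ > 0, the inequality ΔΦ ≥ (n/(n−1)) ‖∇Φ‖²/Φ + ((n²−3n−10)/(2(n−1))) ⟨∇Φ, ∇log ρ⟩ + ((n+2)²/(n−1)) Φ² holds, where ∇, ⟨·,·⟩, ‖·‖ and Δ are taken with respect to the Calabi metric of f. -/
noncomputable section

/-- The `i`-th partial derivative of a function on `ℝⁿ`. -/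
def pd {n : ℕ} (i : Fin n) (f : (Fin n → ℝ) → ℝ) : (Fin n → ℝ) → ℝ :=
  fun x => fderiv ℝ f x (Pi.single i 1)

/-- The Hessian matrix `(∂²f/∂x_i∂x_j)`. -/
def hess {n : ℕ} (f : (Fin n → ℝ) → ℝ) (x : Fin n → ℝ) : Matrix (Fin n) (Fin n) ℝ :=
  Matrix.of fun i j => pd i (pd j f) x

/-- `ρ = (det(f_{ij}))^{−1/(n+2)}`. -/
def rhoF {n : ℕ} (f : (Fin n → ℝ) → ℝ) (x : Fin n → ℝ) : ℝ :=
  (hess f x).det ^ (-(1 : ℝ) / (n + 2))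

/-- `⟨∇φ, ∇ψ⟩ = Σ f^{ij} φ_i ψ_j`, the Calabi-metric inner product of gradients. -/
def calInner {n : ℕ} (f φ ψ : (Fin n → ℝ) → ℝ) (x : Fin n → ℝ) : ℝ :=
  ∑ i : Fin n, ∑ j : Fin n, (hess f x)⁻¹ i j * pd i φ x * pd j ψ x

/-- The Laplace–Beltrami operator of the Calabi metric `G = Σ f_{ij} dx_i dx_j`:
`Δφ = Σ f^{ij} ∂²φ/∂x_i∂x_j + ((n+2)/2)(1/ρ) Σ f^{ij} ρ_j φ_i`. -/
def calLap {n : ℕ} (f φ : (Fin n → ℝ) → ℝ) (x : Fin n → ℝ) : ℝ :=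
  (∑ i : Fin n, ∑ j : Fin n, (hess f x)⁻¹ i j * pd i (pd j φ) x)
    + (((n : ℝ) + 2) / 2) * (1 / rhoF f x) *
        ∑ i : Fin n, ∑ j : Fin n, (hess f x)⁻¹ i j * pd j (rhoF f) x * pd i φ x

/-- `Φ = ‖∇ρ‖²/ρ²`. -/
def PhiF {n : ℕ} (f : (Fin n → ℝ) → ℝ) (x : Fin n → ℝ) : ℝ :=
  calInner f (rhoF f) (rhoF f) x / (rhoF f x) ^ 2


open Matrix Topology

theorem pd_congr {n : ℕ} (k : Fin n) {g h : (Fin n → ℝ) → ℝ} {x : Fin n → ℝ}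
    (e : g =ᶠ[𝓝 x] h) : pd k g x = pd k h x := by
  unfold pd; rw [e.fderiv_eq]

/-- Entrywise partial derivative of a matrix-valued function. -/
def mD {n : ℕ} (k : Fin n) (M : (Fin n → ℝ) → Matrix (Fin n) (Fin n) ℝ) (x : Fin n → ℝ) :
    Matrix (Fin n) (Fin n) ℝ := Matrix.of fun i j => pd k (fun y => M y i j) x

/-- Entrywise differentiability. -/
def mDiff {n : ℕ} (M : (Fin n → ℝ) → Matrix (Fin n) (Fin n) ℝ) (x : Fin n → ℝ) : Prop :=
  ∀ i j, DifferentiableAt ℝ (fun y => M y i j) x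

theorem pd_mul {n : ℕ} (k : Fin n) {g h : (Fin n → ℝ) → ℝ} {x : Fin n → ℝ}
    (hg : DifferentiableAt ℝ g x) (hh : DifferentiableAt ℝ h x) :
    pd k (fun y => g y * h y) x = pd k g x * h x + g x * pd k h x := by
  unfold pd; rw [fderiv_fun_mul hg hh]; simp; ring

theorem pd_sum {n : ℕ} {ι : Type*} (s : Finset ι) (k : Fin n) {g : ι → (Fin n → ℝ) → ℝ}
    {x : Fin n → ℝ}
    (hg : ∀ i ∈ s, DifferentiableAt ℝ (g i) x) :
    pd k (fun y => ∑ i ∈ s, g i y) x = ∑ i ∈ s, pd k (g i) x := by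
  unfold pd; rw [fderiv_fun_sum hg]; simp

theorem mDiff.mul {n : ℕ} {M N : (Fin n → ℝ) → Matrix (Fin n) (Fin n) ℝ} {x : Fin n → ℝ}
    (hM : mDiff M x) (hN : mDiff N x) : mDiff (fun y => M y * N y) x := by
  intro i j
  simp only [Matrix.mul_apply]
  exact DifferentiableAt.fun_sum fun l _ => (hM i l).fun_mul (hN l j)

theorem mD_mul {n : ℕ} (k : Fin n) {M N : (Fin n → ℝ) → Matrix (Fin n) (Fin n) ℝ}
    {x : Fin n → ℝ} (hM : mDiff M x) (hN : mDiff N x) :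
    mD k (fun y => M y * N y) x = mD k M x * N x + M x * mD k N x := by
  ext i j
  simp only [mD, Matrix.mul_apply, Matrix.of_apply, Matrix.add_apply]
  rw [pd_sum _ _ (fun l _ => (hM i l).fun_mul (hN l j)), ← Finset.sum_add_distrib]
  exact Finset.sum_congr rfl fun l _ => pd_mul k (hM i l) (hN l j)

theorem mD_congr {n : ℕ} (k : Fin n) {M N : (Fin n → ℝ) → Matrix (Fin n) (Fin n) ℝ}
    {x : Fin n → ℝ} (e : M =ᶠ[𝓝 x] N) : mD k M x = mD k N x := by
  ext i j
  exact pd_congr k (e.mono fun y hy => by simp [hy])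

theorem mDiff.det {n : ℕ} {M : (Fin n → ℝ) → Matrix (Fin n) (Fin n) ℝ} {x : Fin n → ℝ}
    (hM : mDiff M x) : DifferentiableAt ℝ (fun y => (M y).det) x := by
  simp only [Matrix.det_apply]
  refine DifferentiableAt.fun_sum fun σ _ => ?_
  refine DifferentiableAt.fun_const_smul ?_ _
  exact (HasFDerivAt.finsetProd (fun i _ => (hM (σ i) i).hasFDerivAt)).differentiableAt

theorem mDiff.inv {n : ℕ} {M : (Fin n → ℝ) → Matrix (Fin n) (Fin n) ℝ} {x : Fin n → ℝ}
    (hM : mDiff M x) (h0 : (M x).det ≠ 0) : mDiff (fun y => (M y)⁻¹) x := by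
  intro i j
  simp only [Matrix.inv_def, Matrix.smul_apply, Ring.inverse_eq_inv', smul_eq_mul,
    Matrix.adjugate_apply]
  refine (hM.det.fun_inv h0).fun_mul ?_
  refine mDiff.det (M := fun y => (M y).updateRow j (Pi.single i 1)) ?_
  intro a b
  by_cases h : a = j
  · subst h; simp
  · simpa [Matrix.updateRow_ne h] using hM a b

theorem mD_inv {n : ℕ} (k : Fin n) {M : (Fin n → ℝ) → Matrix (Fin n) (Fin n) ℝ} {x : Fin n → ℝ}
    (hM : mDiff M x) (h0 : ∀ᶠ y in 𝓝 x, (M y).det ≠ 0) :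
    mD k (fun y => (M y)⁻¹) x = - ((M x)⁻¹ * mD k M x * (M x)⁻¹) := by
  have hx := h0.self_of_nhds
  have hu : IsUnit (M x).det := isUnit_iff_ne_zero.2 hx
  have e : mD k (fun y => (M y)⁻¹ * M y) x = 0 := by
    rw [mD_congr k (N := fun _ => 1)
      (h0.mono fun y hy => Matrix.nonsing_inv_mul _ (isUnit_iff_ne_zero.2 hy))]
    ext i j; simp [mD, pd]
  rw [mD_mul k (hM.inv hx) hM] at e
  have e2 := congrArg (· * (M x)⁻¹) e
  simp only [Matrix.add_mul, Matrix.zero_mul, Matrix.mul_assoc, Matrix.mul_nonsing_inv _ hu,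
    Matrix.mul_one] at e2
  rw [Matrix.mul_assoc]
  exact eq_neg_of_add_eq_zero_left e2

theorem pd_det {n : ℕ} (k : Fin n) {M : (Fin n → ℝ) → Matrix (Fin n) (Fin n) ℝ} {x : Fin n → ℝ}
    (hM : mDiff M x) (h0 : (M x).det ≠ 0) :
    pd k (fun y => (M y).det) x = (M x).det * ((M x)⁻¹ * mD k M x).trace := by
  let F : ContinuousMultilinearMap ℝ (fun _ : Fin n => (Fin n → ℝ)) ℝ :=
    ⟨(Matrix.detRowAlternating (n := Fin n) (R := ℝ)).toMultilinearMap,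
      Continuous.matrix_det (A := fun m : Fin n → Fin n → ℝ => Matrix.of m) continuous_id⟩
  have hF : ∀ m : Fin n → Fin n → ℝ, F m = (Matrix.of m).det := fun m => rfl
  have hMd : HasFDerivAt (fun y => (fun i j => M y i j : Fin n → Fin n → ℝ))
      (ContinuousLinearMap.pi fun i => ContinuousLinearMap.pi fun j =>
        fderiv ℝ (fun y => M y i j) x) x := by
    rw [hasFDerivAt_pi]; intro i; rw [hasFDerivAt_pi]; intro j
    exact (hM i j).hasFDerivAt
  have h1 := (F.hasFDerivAt (x := fun i j => M x i j)).comp x hMd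
  have h2 : pd k (fun y => (M y).det) x
      = F.linearDeriv (fun i j => M x i j) (fun i j => mD k M x i j) := by
    unfold pd
    have : fderiv ℝ (fun y => (M y).det) x = _ := h1.fderiv
    rw [this]; rfl
  rw [h2, ContinuousMultilinearMap.linearDeriv_apply, Matrix.inv_def, Ring.inverse_eq_inv',
    Matrix.smul_mul, Matrix.trace_smul, smul_eq_mul, mul_inv_cancel_left₀ h0, Matrix.trace_mul_comm]
  simp only [Matrix.trace, Matrix.diag]
  refine Finset.sum_congr rfl fun i _ => ?_
  have : F (Function.update (fun i j => M x i j) i fun j => mD k M x i j)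
     = ((M x).updateRow i (mD k M x i)).det := rfl
  rw [this, ← Matrix.cramer_transpose_apply, Matrix.cramer_eq_adjugate_mulVec,
    ← Matrix.adjugate_transpose]
  simp [Matrix.mulVec, dotProduct, Matrix.mul_apply, mul_comm]

theorem pd_smooth {n : ℕ} (k : Fin n) {Ω : Set (Fin n → ℝ)} (hΩ : IsOpen Ω)
    {g : (Fin n → ℝ) → ℝ} (hg : ContDiffOn ℝ (⊤ : ℕ∞) g Ω) :
    ContDiffOn ℝ (⊤ : ℕ∞) (pd k g) Ω := by
  unfold pd
  exact (hg.fderiv_of_isOpen hΩ (m := (⊤ : ℕ∞)) (by simp)).clm_apply contDiffOn_const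

theorem pd_comm {n : ℕ} (k l : Fin n) {Ω : Set (Fin n → ℝ)} (hΩ : IsOpen Ω)
    {g : (Fin n → ℝ) → ℝ} (hg : ContDiffOn ℝ (⊤ : ℕ∞) g Ω) {x : Fin n → ℝ} (hx : x ∈ Ω) :
    pd k (pd l g) x = pd l (pd k g) x := by
  have hgx : ContDiffAt ℝ (⊤ : ℕ∞) g x := hg.contDiffAt (hΩ.mem_nhds hx)
  have hs : IsSymmSndFDerivAt ℝ g x := hgx.isSymmSndFDerivAt (by simp; exact WithTop.coe_le_coe.2 (le_top (a := (2 : ℕ∞))))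
  have hd : DifferentiableAt ℝ (fderiv ℝ g) x :=
    ((hg.fderiv_of_isOpen hΩ (m := (⊤ : ℕ∞)) (by simp)).contDiffAt
      (hΩ.mem_nhds hx)).differentiableAt (by simp)
  have key : ∀ a b : Fin n, pd a (pd b g) x
      = fderiv ℝ (fderiv ℝ g) x (Pi.single a 1) (Pi.single b 1) := by
    intro a b
    unfold pd
    rw [fderiv_clm_apply hd (by fun_prop)]
    simp
  rw [key, key]; exact hs _ _

theorem eucl_ineq {n : ℕ} (hn : 2 ≤ n) (A : Matrix (Fin n) (Fin n) ℝ) (hA : Aᵀ = A)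
    (v : Fin n → ℝ) (hv : 0 < v ⬝ᵥ v) :
    2 * ((A *ᵥ v) ⬝ᵥ (A *ᵥ v)) / (v ⬝ᵥ v) - ((A *ᵥ v) ⬝ᵥ v) ^ 2 / (v ⬝ᵥ v) ^ 2
      + (A.trace - ((A *ᵥ v) ⬝ᵥ v) / (v ⬝ᵥ v)) ^ 2 / ((n : ℝ) - 1) ≤ (A * A).trace := by
  have hn' : (0 : ℝ) < (n : ℝ) - 1 := by
    have : (2 : ℝ) ≤ n := by exact_mod_cast hn
    linarith
  set w := A *ᵥ v with hw
  have hw' : v ᵥ* A = w := by rw [hw, ← Matrix.vecMul_transpose, hA]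
  set p := v ⬝ᵥ v with hp
  set s := w ⬝ᵥ v with hs
  have hs' : v ⬝ᵥ w = s := dotProduct_comm _ _
  set t := A.trace with ht
  have hAw : w ⬝ᵥ (A *ᵥ v) = w ⬝ᵥ w := rfl
  set r := w ⬝ᵥ w with hr
  set μ := (t - s / p) / ((n : ℝ) - 1) with hμ
  set β := s / p ^ 2 + μ / p with hβ
  let B : Matrix (Fin n) (Fin n) ℝ := A - p⁻¹ • vecMulVec v w - p⁻¹ • vecMulVec w v
    + β • vecMulVec v v - μ • 1
  have hBt : Bᵀ = B := by
    simp only [B, Matrix.transpose_sub, Matrix.transpose_add, Matrix.transpose_smul,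
      Matrix.transpose_vecMulVec, Matrix.transpose_one, hA]
    abel
  have h0 : 0 ≤ (B * B).trace := by
    have : 0 ≤ (B * Bᵀ).trace := by
      simp only [Matrix.trace, Matrix.diag, Matrix.mul_apply, Matrix.transpose_apply]
      exact Finset.sum_nonneg fun i _ => Finset.sum_nonneg fun j _ => mul_self_nonneg _
    rwa [hBt] at this
  have e1 : (A * vecMulVec v w).trace = r := by
    rw [Matrix.mul_vecMulVec, Matrix.trace_vecMulVec]
  have e2 : (A * vecMulVec w v).trace = r := by
    rw [Matrix.trace_mul_comm, Matrix.vecMulVec_mul, hw', Matrix.trace_vecMulVec]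
  have e3 : (A * vecMulVec v v).trace = s := by
    rw [Matrix.mul_vecMulVec, Matrix.trace_vecMulVec]
  have e1' : (vecMulVec v w * A).trace = r := by rw [Matrix.trace_mul_comm, e1]
  have e2' : (vecMulVec w v * A).trace = r := by rw [Matrix.trace_mul_comm, e2]
  have e3' : (vecMulVec v v * A).trace = s := by rw [Matrix.trace_mul_comm, e3]
  have hB : (B * B).trace = (A * A).trace + 2 * (-2 * p⁻¹ * r + β * s - μ * t)
      + p⁻¹ ^ 2 * (2 * s ^ 2 + 2 * r * p) + β ^ 2 * p ^ 2 + μ ^ 2 * n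
      - 4 * p⁻¹ * β * s * p + 4 * p⁻¹ * μ * s - 2 * β * μ * p := by
    simp only [B, Matrix.mul_sub, Matrix.sub_mul, Matrix.mul_add, Matrix.add_mul,
      Matrix.trace_sub, Matrix.trace_add, Matrix.smul_mul, Matrix.mul_smul, Matrix.trace_smul,
      Matrix.mul_one, Matrix.one_mul, e1, e2, e3, e1', e2', e3',
      Matrix.vecMulVec_mul_vecMulVec, Matrix.trace_vecMulVec, smul_eq_mul, Matrix.trace_one,
      Fintype.card_fin, hs', ← hs, ← hp, ← hr, ← ht, Matrix.vecMulVec_smul]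
    ring
  have hp0 : p ≠ 0 := hv.ne'
  have hq : μ * ((n : ℝ) - 1) = t - s / p := by rw [hμ]; field_simp
  have hfin : (B * B).trace = (A * A).trace - 2 * r / p + s ^ 2 / p ^ 2
      - (t - s / p) ^ 2 / ((n : ℝ) - 1) := by
    have hq2 : (t - s / p) ^ 2 / ((n : ℝ) - 1) = μ ^ 2 * ((n : ℝ) - 1) := by
      rw [hμ]; field_simp
    have ht2 : t = μ * ((n : ℝ) - 1) + s / p := by rw [hq]; ring
    rw [hB, hq2, hβ, ht2]
    clear_value μ
    field_simp
    ring
  linarith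

open scoped MatrixOrder Matrix.Norms.L2Operator in
theorem exists_star_mul {n : ℕ} {H : Matrix (Fin n) (Fin n) ℝ} (hH : H.PosSemidef) :
    ∃ P : Matrix (Fin n) (Fin n) ℝ, H = Pᵀ * P := by
  obtain ⟨P, hP⟩ := CStarAlgebra.nonneg_iff_eq_star_mul_self.mp hH.nonneg
  exact ⟨P, by rw [hP, Matrix.star_eq_conjTranspose, Matrix.conjTranspose_eq_transpose_of_trivial]⟩

theorem alg_ineq {n : ℕ} (hn : 2 ≤ n) (H T : Matrix (Fin n) (Fin n) ℝ) (hH : H.PosDef)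
    (hT : Tᵀ = T) (c q : Fin n → ℝ) (p : ℝ) (hp : p = c ⬝ᵥ (H⁻¹ *ᵥ c)) (hp0 : 0 < p)
    (hq : q = -(T *ᵥ (H⁻¹ *ᵥ c))) (htr : (H⁻¹ * T).trace = -((n : ℝ) + 2) * p) :
    (H⁻¹ * T * H⁻¹ * T).trace + ((n : ℝ) + 2) / 2 * (q ⬝ᵥ (H⁻¹ *ᵥ c)) ≥
      ((n : ℝ) / ((n : ℝ) - 1)) * (q ⬝ᵥ (H⁻¹ *ᵥ q)) / p
          + (((n : ℝ) ^ 2 - 3 * (n : ℝ) - 10) / (2 * ((n : ℝ) - 1))) * (q ⬝ᵥ (H⁻¹ *ᵥ c))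
          + (((n : ℝ) + 2) ^ 2 / ((n : ℝ) - 1)) * p ^ 2 := by
  have hn' : (0 : ℝ) < (n : ℝ) - 1 := by
    have : (2 : ℝ) ≤ n := by exact_mod_cast hn
    linarith
  obtain ⟨P, hP⟩ : ∃ P : Matrix (Fin n) (Fin n) ℝ, H⁻¹ = Pᵀ * P := by
    obtain ⟨P, hP⟩ := exists_star_mul hH.inv.posSemidef
    exact ⟨P, hP⟩
  rw [hP] at hp hq htr ⊢
  have hdot : ∀ a b : Fin n → ℝ, a ⬝ᵥ ((Pᵀ * P) *ᵥ b) = (P *ᵥ a) ⬝ᵥ (P *ᵥ b) := by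
    intro a b
    rw [← Matrix.mulVec_mulVec, Matrix.dotProduct_mulVec, Matrix.vecMul_transpose]
  simp only [hdot] at hp ⊢
  set v := P *ᵥ c with hv
  let A := P * T * Pᵀ
  have hA : Aᵀ = A := by simp [A, Matrix.transpose_mul, hT, Matrix.mul_assoc]
  have hAv : P *ᵥ q = -(A *ᵥ v) := by
    rw [hq, hv, Matrix.mulVec_neg]; simp [A, Matrix.mulVec_mulVec, Matrix.mul_assoc]
  have htA : A.trace = -((n : ℝ) + 2) * p := by
    rw [← htr, Matrix.trace_mul_comm, ← Matrix.mul_assoc]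
  have htA2 : (Pᵀ * P * T * (Pᵀ * P) * T).trace = (A * A).trace := by
    have : Pᵀ * P * T * (Pᵀ * P) * T = Pᵀ * (P * T * Pᵀ * P * T) := by simp [Matrix.mul_assoc]
    rw [this, Matrix.trace_mul_comm]
    simp [A, Matrix.mul_assoc]
  have key := eucl_ineq hn A hA v (hp ▸ hp0)
  have cs : ((A *ᵥ v) ⬝ᵥ v) ^ 2 ≤ ((A *ᵥ v) ⬝ᵥ (A *ᵥ v)) * (v ⬝ᵥ v) := by
    have := Finset.sum_mul_sq_le_sq_mul_sq Finset.univ (A *ᵥ v) v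
    simpa [dotProduct, pow_two] using this
  rw [htA2, hAv]
  simp only [neg_dotProduct, dotProduct_neg, neg_neg]
  rw [htA, ← hp] at key
  rw [← hp] at cs
  set s := (A *ᵥ v) ⬝ᵥ v
  set r := (A *ᵥ v) ⬝ᵥ (A *ᵥ v)
  refine ge_iff_le.2 ?_
  have hn2 : (0 : ℝ) ≤ (n : ℝ) - 2 := by
    have : (2 : ℝ) ≤ n := by exact_mod_cast hn
    linarith
  have extra : 0 ≤ (((n : ℝ) - 2) / ((n : ℝ) - 1)) * ((r * p - s ^ 2) / p ^ 2) := by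
    have : 0 ≤ r * p - s ^ 2 := by linarith
    positivity
  have ident : (2 * r / p - s ^ 2 / p ^ 2
      + (-((n : ℝ) + 2) * p - s / p) ^ 2 / ((n : ℝ) - 1)) + ((n : ℝ) + 2) / 2 * -s
      = ((n : ℝ) / ((n : ℝ) - 1)) * r / p
          + (((n : ℝ) ^ 2 - 3 * (n : ℝ) - 10) / (2 * ((n : ℝ) - 1))) * -s
          + (((n : ℝ) + 2) ^ 2 / ((n : ℝ) - 1)) * p ^ 2
        + (((n : ℝ) - 2) / ((n : ℝ) - 1)) * ((r * p - s ^ 2) / p ^ 2) := by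
    field_simp
    ring
  linarith

theorem pd_quad {n : ℕ} (k : Fin n) {M : (Fin n → ℝ) → Matrix (Fin n) (Fin n) ℝ}
    {x : Fin n → ℝ} (hM : mDiff M x) (c : Fin n → ℝ) :
    pd k (fun y => c ⬝ᵥ (M y *ᵥ c)) x = c ⬝ᵥ (mD k M x *ᵥ c) := by
  simp only [dotProduct, Matrix.mulVec]
  have h1 : ∀ i j, DifferentiableAt ℝ (fun y => M y i j * c j) x := fun i j =>
    (hM i j).fun_mul (differentiableAt_const _)
  have h2 : ∀ i, DifferentiableAt ℝ (fun y => ∑ j, M y i j * c j) x := fun i =>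
    DifferentiableAt.fun_sum fun j _ => h1 i j
  have hc : ∀ a : ℝ, pd k (fun _ => a) x = 0 := by intro a; simp [pd]
  rw [pd_sum _ _ fun i _ => (differentiableAt_const _).fun_mul (h2 i)]
  refine Finset.sum_congr rfl fun i _ => ?_
  rw [pd_mul k (differentiableAt_const _) (h2 i), pd_sum _ _ fun j _ => h1 i j, hc, zero_mul,
    zero_add]
  congr 1
  refine Finset.sum_congr rfl fun j _ => ?_
  rw [pd_mul k (hM i j) (differentiableAt_const _), hc, mul_zero, add_zero]
  rfl

theorem pd_trace {n : ℕ} (k : Fin n) {M : (Fin n → ℝ) → Matrix (Fin n) (Fin n) ℝ}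
    {x : Fin n → ℝ} (hM : mDiff M x) :
    pd k (fun y => (M y).trace) x = (mD k M x).trace := by
  simp only [Matrix.trace, Matrix.diag]
  rw [pd_sum _ _ fun i _ => hM i i]
  rfl

theorem pd_neg {n : ℕ} (k : Fin n) {g : (Fin n → ℝ) → ℝ} {x : Fin n → ℝ} :
    pd k (fun y => - g y) x = - pd k g x := by
  unfold pd; rw [fderiv_fun_neg]; simp

theorem pd_affine {n : ℕ} (k : Fin n) (c : Fin n → ℝ) (a : ℝ) (x : Fin n → ℝ) :
    pd k (fun y => (∑ i, c i * y i) + a) x = c k := by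
  have h : HasFDerivAt (fun y : Fin n → ℝ => (∑ i, c i * y i) + a)
      (∑ i, c i • (ContinuousLinearMap.proj i : (Fin n → ℝ) →L[ℝ] ℝ)) x := by
    refine HasFDerivAt.add_const _ ?_
    refine HasFDerivAt.fun_sum fun i _ => ?_
    exact (hasFDerivAt_apply i x).const_mul (c i)
  unfold pd
  rw [h.fderiv]
  simp [Pi.single_apply]

theorem pd_exp_affine {n : ℕ} (k : Fin n) (c : Fin n → ℝ) (a : ℝ) (x : Fin n → ℝ) :
    pd k (fun y => Real.exp ((∑ i, c i * y i) + a)) x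
      = Real.exp ((∑ i, c i * x i) + a) * c k := by
  have h : DifferentiableAt ℝ (fun y : Fin n → ℝ => (∑ i, c i * y i) + a) x := by fun_prop
  have := pd_affine k c a x
  unfold pd at *
  rw [fderiv_exp h, _root_.smul_apply, this, smul_eq_mul]

theorem sum_eq_trace {n : ℕ} (G M : Matrix (Fin n) (Fin n) ℝ) (hG : Gᵀ = G) :
    ∑ i, ∑ j, G i j * M i j = (G * M).trace := by
  simp only [Matrix.trace, Matrix.diag, Matrix.mul_apply]
  rw [Finset.sum_comm]
  refine Finset.sum_congr rfl fun i _ => Finset.sum_congr rfl fun j _ => ?_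
  rw [show G j i = G i j from congrFun (congrFun hG i) j]

theorem lap_alg {n : ℕ} (G : Matrix (Fin n) (Fin n) ℝ) (hG : Gᵀ = G)
    (h : Fin n → Matrix (Fin n) (Fin n) ℝ) (h4 : Fin n → Fin n → Matrix (Fin n) (Fin n) ℝ)
    (s1 : ∀ k i j, h k i j = h k j i) (s2 : ∀ k i j, h k i j = h i k j)
    (s4 : ∀ k l i j, h4 k l i j = h4 i j k l)
    (htr : ∀ k l, (G * h4 k l).trace = (G * h k * G * h l).trace)
    (c : Fin n → ℝ) (T : Matrix (Fin n) (Fin n) ℝ) (hT : T = ∑ k, (G *ᵥ c) k • h k) :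
    ∑ k, ∑ l, G k l * -(c ⬝ᵥ (((-(G * h k * G) * h l + G * h4 k l) * G
      + G * h l * -(G * h k * G)) *ᵥ c)) = (G * T * G * T).trace := by
  set p := G *ᵥ c with hp
  have hp' : c ᵥ* G = p := by rw [hp, ← Matrix.vecMul_transpose, hG]
  have hTs : Tᵀ = T := by
    ext i j
    simp only [hT, Matrix.transpose_apply, Matrix.sum_apply, Matrix.smul_apply]
    exact Finset.sum_congr rfl fun k _ => by rw [s1]
  have hv : ∀ k, h k *ᵥ p = T k := by
    intro k; ext i
    simp only [hT, Matrix.sum_apply, Matrix.smul_apply, Matrix.mulVec, dotProduct, smul_eq_mul]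
    refine Finset.sum_congr rfl fun j _ => ?_
    rw [s1 k i j, s2 k j i, mul_comm]
  have hv' : ∀ k, p ᵥ* h k = T k := by
    intro k
    rw [← hv k, ← Matrix.mulVec_transpose]
    congr 1; ext i j; exact s1 _ _ _
  have hq : ∀ k l, p ⬝ᵥ ((h k * G * h l) *ᵥ p) = (T * G * T) k l := by
    intro k l
    rw [← Matrix.mulVec_mulVec, ← Matrix.mulVec_mulVec, hv, Matrix.dotProduct_mulVec, hv']
    rw [Matrix.mul_assoc, Matrix.mul_apply]
    simp only [dotProduct]
    refine Finset.sum_congr rfl fun a _ => ?_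
    congr 1
    simp only [Matrix.mulVec, dotProduct, Matrix.mul_apply]
    refine Finset.sum_congr rfl fun b _ => ?_
    congr 1
    exact congrFun (congrFun hTs b) l
  have hterm : ∀ k l, -(c ⬝ᵥ (((-(G * h k * G) * h l + G * h4 k l) * G
      + G * h l * -(G * h k * G)) *ᵥ c))
      = (T * G * T) k l + (T * G * T) l k - p ⬝ᵥ (h4 k l *ᵥ p) := by
    intro k l
    have hc : ∀ M : Matrix (Fin n) (Fin n) ℝ, c ⬝ᵥ ((G * M * G) *ᵥ c) = p ⬝ᵥ (M *ᵥ p) := by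
      intro M
      rw [← Matrix.mulVec_mulVec, ← Matrix.mulVec_mulVec, Matrix.dotProduct_mulVec, hp']
    have hM : ((-(G * h k * G) * h l + G * h4 k l) * G + G * h l * -(G * h k * G))
        = G * (h4 k l) * G - G * (h k * G * h l) * G - G * (h l * G * h k) * G := by
      noncomm_ring
    rw [hM, Matrix.sub_mulVec, Matrix.sub_mulVec, dotProduct_sub, dotProduct_sub, hc, hc, hc,
      hq, hq]
    ring
  simp only [hterm, mul_sub, mul_add, Finset.sum_sub_distrib, Finset.sum_add_distrib]
  have hS : (T * G * T)ᵀ = T * G * T := by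
    simp [Matrix.transpose_mul, hTs, hG, Matrix.mul_assoc]
  have a1 : ∑ k, ∑ l, G k l * (T * G * T) k l = (G * T * G * T).trace := by
    rw [sum_eq_trace G _ hG]; simp [Matrix.mul_assoc]
  have a2 : ∑ k, ∑ l, G k l * (T * G * T) l k = (G * T * G * T).trace := by
    rw [← a1]
    refine Finset.sum_congr rfl fun i _ => Finset.sum_congr rfl fun j _ => ?_
    congr 1
    exact congrFun (congrFun hS i) j
  have a3 : ∑ k, ∑ l, G k l * p ⬝ᵥ (h4 k l *ᵥ p) = (G * T * G * T).trace := by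
    have b1 : (G * T * G * T).trace = ∑ a, ∑ b, p a * p b * (G * h a * G * h b).trace := by
      rw [hT]
      simp only [Matrix.mul_sum, Matrix.sum_mul, Matrix.trace_sum, Matrix.mul_smul,
        Matrix.smul_mul, Matrix.trace_smul, smul_eq_mul]
      rw [Finset.sum_comm]
      simp only [Finset.mul_sum]
      refine Finset.sum_congr rfl fun a _ => Finset.sum_congr rfl fun b _ => by ring
    rw [b1]
    simp only [← htr, ← sum_eq_trace G _ hG, dotProduct, Matrix.mulVec, Finset.mul_sum]
    have e : ∀ k l i j, G k l * (p i * (h4 k l i j * p j)) = p i * p j * (G k l * h4 i j k l) := by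
      intro k l i j; rw [s4]; ring
    simp only [e]
    calc _ = ∑ k, ∑ i, ∑ l, ∑ j, p i * p j * (G k l * h4 i j k l) :=
          Finset.sum_congr rfl fun k _ => Finset.sum_comm
      _ = ∑ i, ∑ k, ∑ l, ∑ j, p i * p j * (G k l * h4 i j k l) := Finset.sum_comm
      _ = ∑ i, ∑ k, ∑ j, ∑ l, p i * p j * (G k l * h4 i j k l) :=
          Finset.sum_congr rfl fun i _ => Finset.sum_congr rfl fun k _ => Finset.sum_comm
      _ = _ := Finset.sum_congr rfl fun i _ => Finset.sum_comm
  rw [a1, a2, a3]; ring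

/-- Proposition 3.1: for a smooth strictly convex solution of
`det(f_{ij}) = exp(Σ d_i x_i + d_0)`, at every point where `Φ > 0`:
`ΔΦ ≥ (n/(n−1))‖∇Φ‖²/Φ + ((n²−3n−10)/(2(n−1)))⟨∇Φ, ∇log ρ⟩ + ((n+2)²/(n−1))Φ²`. -/
theorem prop_3_1 (n : ℕ) (hn : 2 ≤ n)
    (Ω : Set (Fin n → ℝ)) (hΩo : IsOpen Ω)
    (f : (Fin n → ℝ) → ℝ) (hf : ContDiffOn ℝ (⊤ : ℕ∞) f Ω)
    (hconv : ∀ x ∈ Ω, (hess f x).PosDef)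
    (d : Fin n → ℝ) (d0 : ℝ)
    (hpde : ∀ x ∈ Ω,
      (hess f x).det = Real.exp ((∑ i : Fin n, d i * x i) + d0)) :
    ∀ x ∈ Ω, 0 < PhiF f x →
      calLap f (PhiF f) x ≥
        ((n : ℝ) / ((n : ℝ) - 1)) * calInner f (PhiF f) (PhiF f) x / PhiF f x
          + (((n : ℝ) ^ 2 - 3 * (n : ℝ) - 10) / (2 * ((n : ℝ) - 1))) *
              calInner f (PhiF f) (fun y => Real.log (rhoF f y)) x
          + (((n : ℝ) + 2) ^ 2 / ((n : ℝ) - 1)) * (PhiF f x) ^ 2 := by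
  intro x hx hpos
  have hn2 : ((n : ℝ) + 2) ≠ 0 := by positivity
  set c : Fin n → ℝ := fun i => -(1 : ℝ) / (n + 2) * d i with hc
  set c0 : ℝ := -(1 : ℝ) / (n + 2) * d0 with hc0
  have hnh : ∀ y ∈ Ω, ∀ᶠ z in 𝓝 y, z ∈ Ω := fun y hy => hΩo.mem_nhds hy
  have hdet : ∀ y ∈ Ω, (hess f y).det ≠ 0 := fun y hy => (hconv y hy).det_pos.ne'
  have hrho : ∀ y ∈ Ω, rhoF f y = Real.exp ((∑ i, c i * y i) + c0) := by
    intro y hy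
    rw [rhoF, hpde y hy, ← Real.exp_mul]
    congr 1
    rw [add_mul, Finset.sum_mul, hc0]
    congr 1
    · refine Finset.sum_congr rfl fun i _ => ?_
      simp only [hc]; ring
    · ring
  have hrho0 : ∀ y ∈ Ω, rhoF f y ≠ 0 := fun y hy => by rw [hrho y hy]; exact (Real.exp_pos _).ne'
  have hpdrho : ∀ y ∈ Ω, ∀ k, pd k (rhoF f) y = rhoF f y * c k := by
    intro y hy k
    rw [pd_congr k ((hnh y hy).mono hrho), pd_exp_affine, hrho y hy]
  have hlog : ∀ k, pd k (fun y => Real.log (rhoF f y)) x = c k := by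
    intro k
    rw [pd_congr k (h := fun y => (∑ i, c i * y i) + c0)
      ((hnh x hx).mono fun y hy => by simp only [hrho y hy, Real.log_exp]), pd_affine]
  -- inner products
  have hin : ∀ y (φ ψ : (Fin n → ℝ) → ℝ), calInner f φ ψ y
      = (fun i => pd i φ y) ⬝ᵥ ((hess f y)⁻¹ *ᵥ (fun i => pd i ψ y)) := by
    intro y φ ψ
    simp only [calInner, dotProduct, Matrix.mulVec, Finset.mul_sum]
    refine Finset.sum_congr rfl fun i _ => Finset.sum_congr rfl fun j _ => by ring
  have hPhi : ∀ y ∈ Ω, PhiF f y = c ⬝ᵥ ((hess f y)⁻¹ *ᵥ c) := by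
    intro y hy
    have e : (fun i => pd i (rhoF f) y) = rhoF f y • c := by
      ext i; simp [hpdrho y hy i]
    have h0 := hrho0 y hy
    rw [PhiF, hin, e, Matrix.mulVec_smul, dotProduct_smul, smul_dotProduct, smul_eq_mul,
      smul_eq_mul]
    field_simp
  -- smoothness
  have hs1 : ∀ i, ContDiffOn ℝ (⊤ : ℕ∞) (pd i f) Ω := fun i => pd_smooth i hΩo hf
  have hs2 : ∀ i j, ContDiffOn ℝ (⊤ : ℕ∞) (pd i (pd j f)) Ω := fun i j => pd_smooth i hΩo (hs1 j)
  have hs3 : ∀ k i j, ContDiffOn ℝ (⊤ : ℕ∞) (pd k (pd i (pd j f))) Ω :=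
    fun k i j => pd_smooth k hΩo (hs2 i j)
  have hHd : ∀ y ∈ Ω, mDiff (hess f) y := fun y hy i j =>
    ((hs2 i j).contDiffAt (hΩo.mem_nhds hy)).differentiableAt (by simp)
  have hHkd : ∀ k, ∀ y ∈ Ω, mDiff (mD k (hess f)) y := fun k y hy i j =>
    ((hs3 k i j).contDiffAt (hΩo.mem_nhds hy)).differentiableAt (by simp)
  have hGd : ∀ y ∈ Ω, mDiff (fun z => (hess f z)⁻¹) y := fun y hy => (hHd y hy).inv (hdet y hy)
  have hDG : ∀ k, ∀ y ∈ Ω, mD k (fun z => (hess f z)⁻¹) y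
      = -((hess f y)⁻¹ * mD k (hess f) y * (hess f y)⁻¹) := fun k y hy =>
    mD_inv k (hHd y hy) ((hnh y hy).mono hdet)
  have hpPhi : ∀ k, ∀ y ∈ Ω, pd k (PhiF f) y
      = -(c ⬝ᵥ (((hess f y)⁻¹ * mD k (hess f) y * (hess f y)⁻¹) *ᵥ c)) := by
    intro k y hy
    rw [pd_congr k ((hnh y hy).mono hPhi), pd_quad k (hGd y hy), hDG k y hy, Matrix.neg_mulVec,
      dotProduct_neg]
  have hppPhi : ∀ l k, pd l (pd k (PhiF f)) x
      = -(c ⬝ᵥ (((-((hess f x)⁻¹ * mD l (hess f) x * (hess f x)⁻¹) * mD k (hess f) x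
        + (hess f x)⁻¹ * mD l (mD k (hess f)) x) * (hess f x)⁻¹
        + (hess f x)⁻¹ * mD k (hess f) x *
          -((hess f x)⁻¹ * mD l (hess f) x * (hess f x)⁻¹)) *ᵥ c)) := by
    intro l k
    rw [pd_congr l ((hnh x hx).mono (hpPhi k)), pd_neg,
      pd_quad l (((hGd x hx).mul (hHkd k x hx)).mul (hGd x hx)),
      mD_mul l ((hGd x hx).mul (hHkd k x hx)) (hGd x hx),
      mD_mul l (hGd x hx) (hHkd k x hx), hDG l x hx]
  -- the equation, differentiated
  have htr1 : ∀ k, ∀ y ∈ Ω, ((hess f y)⁻¹ * mD k (hess f) y).trace = d k := by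
    intro k y hy
    have e := pd_det k (hHd y hy) (hdet y hy)
    rw [pd_congr k ((hnh y hy).mono hpde), pd_exp_affine, ← hpde y hy] at e
    exact (mul_left_cancel₀ (hdet y hy) e).symm
  have htr2 : ∀ l k, ((hess f x)⁻¹ * mD l (mD k (hess f)) x).trace
      = ((hess f x)⁻¹ * mD l (hess f) x * (hess f x)⁻¹ * mD k (hess f) x).trace := by
    intro l k
    have e := pd_trace l ((hGd x hx).mul (hHkd k x hx))
    rw [pd_congr l (h := fun _ => d k) ((hnh x hx).mono (htr1 k)),
      mD_mul l (hGd x hx) (hHkd k x hx), hDG l x hx, Matrix.trace_add, Matrix.neg_mul,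
      Matrix.trace_neg] at e
    have e0 : pd l (fun _ : Fin n → ℝ => d k) x = 0 := by simp [pd]
    linarith
  -- symmetries
  have sym1 : ∀ k i j, mD k (hess f) x i j = mD k (hess f) x j i := fun k i j =>
    pd_congr k ((hnh x hx).mono fun y hy => pd_comm i j hΩo hf hy)
  have sym2 : ∀ k i j, mD k (hess f) x i j = mD i (hess f) x k j := fun k i j =>
    pd_comm k i hΩo (hs1 j) hx
  have sym4 : ∀ k l i j, mD k (mD l (hess f)) x i j = mD i (mD j (hess f)) x k l := by
    intro k l i j
    calc pd k (pd l (pd i (pd j f))) x = pd k (pd i (pd l (pd j f))) x :=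
          pd_congr k ((hnh x hx).mono fun y hy => pd_comm l i hΩo (hs1 j) hy)
      _ = pd i (pd k (pd l (pd j f))) x := pd_comm k i hΩo (hs2 l j) hx
      _ = pd i (pd k (pd j (pd l f))) x := pd_congr i ((hnh x hx).mono fun y hy =>
          pd_congr k ((hnh y hy).mono fun z hz => pd_comm l j hΩo hf hz))
      _ = pd i (pd j (pd k (pd l f))) x :=
          pd_congr i ((hnh x hx).mono fun y hy => pd_comm k j hΩo (hs1 l) hy)
  have hGs : ((hess f x)⁻¹)ᵀ = (hess f x)⁻¹ := by
    have := (hconv x hx).inv.isHermitian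
    rwa [Matrix.IsHermitian, Matrix.conjTranspose_eq_transpose_of_trivial] at this
  set T : Matrix (Fin n) (Fin n) ℝ := ∑ k, ((hess f x)⁻¹ *ᵥ c) k • mD k (hess f) x with hT
  have hTs : Tᵀ = T := by
    ext i j
    simp only [hT, Matrix.transpose_apply, Matrix.sum_apply, Matrix.smul_apply]
    exact Finset.sum_congr rfl fun k _ => by rw [sym1]
  have hlap := lap_alg _ hGs (fun k => mD k (hess f) x) (fun k l => mD k (mD l (hess f)) x)
    sym1 sym2 sym4 htr2 c T hT
  have hq : (fun k => pd k (PhiF f) x) = -(T *ᵥ ((hess f x)⁻¹ *ᵥ c)) := by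
    have hp' : c ᵥ* (hess f x)⁻¹ = (hess f x)⁻¹ *ᵥ c := by
      rw [← Matrix.vecMul_transpose, hGs]
    ext k
    rw [hpPhi k x hx, ← Matrix.mulVec_mulVec, ← Matrix.mulVec_mulVec, Matrix.dotProduct_mulVec,
      hp', Pi.neg_apply]
    congr 1
    set p := (hess f x)⁻¹ *ᵥ c
    rw [Matrix.dotProduct_mulVec]
    simp only [dotProduct, Matrix.mulVec, Matrix.vecMul, hT, Matrix.sum_apply, Matrix.smul_apply,
      smul_eq_mul]
    refine Finset.sum_congr rfl fun j _ => ?_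
    congr 1
    refine Finset.sum_congr rfl fun i _ => ?_
    rw [sym2]
  have htrT : ((hess f x)⁻¹ * T).trace = -((n : ℝ) + 2) * PhiF f x := by
    rw [hPhi x hx, dotProduct_comm]
    simp only [hT, Matrix.mul_sum, Matrix.mul_smul, Matrix.trace_sum, Matrix.trace_smul,
      htr1 _ x hx, smul_eq_mul, dotProduct, Finset.mul_sum]
    refine Finset.sum_congr rfl fun k _ => ?_
    simp only [hc]
    field_simp
  have main := alg_ineq hn (hess f x) T (hconv x hx) hTs c _ (PhiF f x) (hPhi x hx) hpos hq htrT
  have hL : calLap f (PhiF f) x = ((hess f x)⁻¹ * T * (hess f x)⁻¹ * T).trace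
      + ((n : ℝ) + 2) / 2 * ((fun k => pd k (PhiF f) x) ⬝ᵥ ((hess f x)⁻¹ *ᵥ c)) := by
    rw [calLap, ← hlap]
    congr 1
    · refine Finset.sum_congr rfl fun k _ => Finset.sum_congr rfl fun l _ => ?_
      rw [hppPhi]
    · have h0 := hrho0 x hx
      rw [mul_assoc]
      congr 1
      simp only [dotProduct, Matrix.mulVec, Finset.mul_sum, hpdrho x hx]
      refine Finset.sum_congr rfl fun i _ => Finset.sum_congr rfl fun j _ => ?_
      field_simp
  rw [hL, hin, hin]
  simp only [hlog]
  exact main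
end
end

section
/- Let 2 ≤ n ≤ 4 and let u ∈ C^∞(ℝⁿ) be strictly convex satisfying equation (1.4) on ℝⁿ, normalized so that u ≥ 0 on ℝⁿ and u(0) = 0. Then there exists a constant b > 0 depending only on n such that for every C > 0 and every ξ with u(ξ) < C, one has exp(−8(n−1)C/(C−u(ξ))) · Φ(ξ) ≤ b/C. In particular, letting C → ∞ yields Φ ≡ 0 on ℝⁿ. -/
noncomputable section

/-- `ρ = (det D²u)^{1/(n+2)}`. -/
def rhoU {n : ℕ} (u : (Fin n → ℝ) → ℝ) (x : Fin n → ℝ) : ℝ :=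
  (hess u x).det ^ ((1 : ℝ) / (n + 2))

/-- `Φ = ‖∇ρ‖²/ρ²` with respect to the Calabi metric `G = D²u`. -/
def PhiU {n : ℕ} (u : (Fin n → ℝ) → ℝ) (x : Fin n → ℝ) : ℝ :=
  (1 / (rhoU u x) ^ 2) *
    ∑ i : Fin n, ∑ j : Fin n, (hess u x)⁻¹ i j * pd i (rhoU u) x * pd j (rhoU u) x


lemma second_test (W W1 U U1 : ℝ → ℝ) (W2 U2 C : ℝ) (hW : ∀ t, HasDerivAt W (W1 t) t)
    (hW1 : HasDerivAt W1 W2 0) (hU : ∀ t, HasDerivAt U (U1 t) t)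
    (hU1 : HasDerivAt U1 U2 0) (hC : U 0 < C)
    (hmax : IsLocalMax (fun t => W t * (C - U t) ^ 12) 0) :
    W1 0 * (C - U 0) = 12 * W 0 * U1 0 ∧
    W2 * (C - U 0) ^ 2 - 24 * W1 0 * U1 0 * (C - U 0) - 12 * W 0 * U2 * (C - U 0)
      + 132 * W 0 * (U1 0) ^ 2 ≤ 0 := by
  have hs : 0 < C - U 0 := sub_pos.2 hC
  have h1 : ∀ t, HasDerivAt (fun t => W t * (C - U t) ^ 12)
      (W1 t * (C - U t) ^ 12 + W t * (12 * (C - U t) ^ 11 * (- U1 t))) t := by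
    intro t
    exact ((hW t).mul (((hU t).const_sub C).pow 12)).congr_deriv (by simp)
  have hd : deriv (fun t => W t * (C - U t) ^ 12) =
      fun t => W1 t * (C - U t) ^ 12 + W t * (12 * (C - U t) ^ 11 * (- U1 t)) :=
    funext fun t => (h1 t).deriv
  have h2 : HasDerivAt (fun t => W1 t * (C - U t) ^ 12 + W t * (12 * (C - U t) ^ 11 * (- U1 t)))
      ((C - U 0) ^ 10 * (W2 * (C - U 0) ^ 2 - 24 * W1 0 * U1 0 * (C - U 0)
        - 12 * W 0 * U2 * (C - U 0) + 132 * W 0 * (U1 0) ^ 2)) 0 := by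
    refine ((hW1.mul (((hU 0).const_sub C).pow 12)).add
      ((hW 0).mul (((((hU 0).const_sub C).pow 11).const_mul 12).mul hU1.neg))).congr_deriv ?_
    simp only [Pi.mul_apply, Pi.pow_apply, Pi.neg_apply]
    push_cast
    ring
  have hz := hmax.deriv_eq_zero
  constructor
  · rw [hd] at hz
    have : (C - U 0) ^ 11 * (W1 0 * (C - U 0) - 12 * W 0 * U1 0) = 0 := by
      linear_combination hz
    rcases mul_eq_zero.1 this with h | h
    · exact absurd h (by positivity)
    · linarith
  · by_contra hcon
    push Not at hcon
    have hpos : 0 < deriv (deriv (fun t => W t * (C - U t) ^ 12)) 0 := by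
      rw [hd, h2.deriv]; positivity
    have hmin := isLocalMin_of_deriv_deriv_pos hpos hz (h1 0).continuousAt
    have hconst : (fun t => W t * (C - U t) ^ 12) =ᶠ[nhds 0] fun _ => W 0 * (C - U 0) ^ 12 := by
      filter_upwards [hmin, hmax] with t ha hb
      exact le_antisymm hb ha
    have := hconst.deriv.deriv_eq
    rw [this] at hpos
    simp at hpos

lemma frob {n : ℕ} (B : Fin n → Fin n → ℝ) (dl f : Fin n → ℝ) (hB : ∀ a b, B a b = B b a)
    (w : ℝ) (hw : 0 < w) (hwd : ∑ a, dl a * dl a = w) (hf : ∀ a, f a = ∑ b, B a b * dl b)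
    (l : ℝ) :
    0 ≤ ∑ a, ∑ b, B a b * B a b - 2 * (∑ a, f a * f a) / w + ((∑ a, dl a * f a) / w) ^ 2
      - 2 * l * (∑ a, B a a - (∑ a, dl a * f a) / w) + l ^ 2 * (n - 1) := by
  set be := (∑ a, dl a * f a) / w with hbe
  have hbe' : ∑ a, dl a * f a = be * w := by rw [hbe]; field_simp
  have key : 0 ≤ ∑ a, ∑ b, (B a b - (dl a * f b + f a * dl b) / w + ((be + l) / w) * (dl a * dl b)
      - l * (if a = b then 1 else 0)) ^ 2 :=
    Finset.sum_nonneg fun a _ => Finset.sum_nonneg fun b _ => sq_nonneg _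
  refine key.trans (le_of_eq ?_)
  have inner : ∀ a, ∑ b, (B a b - (dl a * f b + f a * dl b) / w + ((be + l) / w) * (dl a * dl b)
      - l * (if a = b then 1 else 0)) ^ 2 =
      ∑ b, B a b * B a b - (2 / w) * (dl a * ∑ b, B a b * f b) - (2 / w) * (f a * f a)
       + 2 * ((be + l) / w) * (dl a * f a) - 2 * l * B a a
       + (1 / w ^ 2) * ((dl a * dl a) * (∑ b, f b * f b) + 2 * (dl a * f a) * (be * w)
          + f a * f a * w)
       - 2 * ((be + l) / w ^ 2) * (dl a * dl a * (be * w) + f a * dl a * w)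
       + 4 * l / w * (dl a * f a)
       + ((be + l) / w) ^ 2 * (dl a * dl a * w) - 2 * l * ((be + l) / w) * (dl a * dl a) + l ^ 2 := by
    intro a
    have e : ∀ b, (B a b - (dl a * f b + f a * dl b) / w + ((be + l) / w) * (dl a * dl b)
      - l * (if a = b then 1 else 0)) ^ 2 =
       B a b * B a b - (2 / w) * (dl a * (B a b * f b)) - (2 / w) * (f a * (B a b * dl b))
       + 2 * ((be + l) / w) * (dl a * (B a b * dl b)) 
       + (1 / w ^ 2) * ((dl a * dl a) * (f b * f b) + 2 * (dl a * f a) * (dl b * f b)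
          + f a * f a * (dl b * dl b))
       - 2 * ((be + l) / w ^ 2) * (dl a * dl a * (dl b * f b) + f a * dl a * (dl b * dl b))
       + ((be + l) / w) ^ 2 * (dl a * dl a * (dl b * dl b))
       + (if a = b then (- 2 * l * B a b + 2 * l / w * (dl a * f b + f a * dl b)
           - 2 * l * ((be + l) / w) * (dl a * dl b) + l ^ 2) else 0) := by
      intro b
      split_ifs <;> ring
    simp_rw [e]
    simp only [Finset.sum_add_distrib, Finset.sum_sub_distrib, ← Finset.mul_sum, Finset.sum_ite_eq,
      Finset.mem_univ, if_true, hbe', hwd, ← hf]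
    ring
  have hBf : ∑ a, dl a * ∑ b, B a b * f b = ∑ a, f a * f a := by
    simp_rw [Finset.mul_sum]
    rw [Finset.sum_comm]
    refine Finset.sum_congr rfl fun b _ => ?_
    conv_rhs => rw [hf b, Finset.sum_mul]
    rw [← hf b]
    refine Finset.sum_congr rfl fun a _ => ?_
    rw [hB a b]; ring
  have hbe2 : ∑ a, f a * dl a = be * w := by rw [← hbe']; exact Finset.sum_congr rfl fun _ _ => mul_comm _ _
  simp_rw [inner]
  simp only [Finset.sum_add_distrib, Finset.sum_sub_distrib, ← Finset.mul_sum, ← Finset.sum_mul,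
      hbe', hbe2, hwd, hBf, Finset.sum_const, Finset.card_univ, Fintype.card_fin, nsmul_eq_mul]
  field_simp
  ring

lemma algebra_core {n : ℕ} (hn2 : 2 ≤ n) (hn4 : n ≤ 4) (B : Fin n → Fin n → ℝ)
    (dl f U W2 : Fin n → ℝ) (hB : ∀ a b, B a b = B b a)
    (w s : ℝ) (hw : 0 < w) (hs : 0 < s) (hwd : ∑ a, dl a * dl a = w)
    (hf : ∀ a, f a = ∑ b, B a b * dl b) (htr : ∑ a, B a a = - w)
    (h1 : ∀ a, f a * s = 12 * w * U a)
    (hW2 : ∑ a, W2 a = ∑ a, ∑ b, B a b * B a b - ∑ a, dl a * f a)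
    (h2 : ∀ a, W2 a * s ^ 2 - 24 * f a * U a * s - 12 * w * 1 * s + 132 * w * (U a) ^ 2 ≤ 0) :
    w * s ≤ 108 * n := by
  have hUa : ∀ a, U a = f a * s / (12 * w) := by
    intro a; rw [h1 a]; field_simp
  set ff := ∑ a, f a * f a with hff
  set be := (∑ a, dl a * f a) / w with hbe
  have hbe' : ∑ a, dl a * f a = be * w := by rw [hbe]; field_simp
  have hcs : be ^ 2 * w ≤ ff := by
    have := Finset.sum_mul_sq_le_sq_mul_sq Finset.univ dl f
    simp only [pow_two, hwd, hbe', ← hff] at this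
    nlinarith
  have hsum : ∑ a, (W2 a - 12 * w / s - 13 / 12 * (f a * f a) / w) ≤ 0 := by
    refine Finset.sum_nonpos fun a _ => ?_
    have := h2 a
    rw [hUa a] at this
    have e : W2 a * s ^ 2 - 24 * f a * (f a * s / (12 * w)) * s - 12 * w * 1 * s
       + 132 * w * (f a * s / (12 * w)) ^ 2
       = s ^ 2 * (W2 a - 12 * w / s - 13 / 12 * (f a * f a) / w) := by
      field_simp; ring
    rw [e] at this
    by_contra hc
    push Not at hc
    have : 0 < s ^ 2 * (W2 a - 12 * w / s - 13 / 12 * (f a * f a) / w) := by positivity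
    linarith
  simp only [Finset.sum_sub_distrib, ← Finset.mul_sum, ← Finset.sum_div, ← hff, hW2, hbe',
    Finset.sum_const, Finset.card_univ, Fintype.card_fin, nsmul_eq_mul] at hsum
  have hfr := frob B dl f hB w hw hwd hf
  rw [htr, ← hff] at hfr
  simp only [← hbe] at hfr
  set T := ∑ a, ∑ b, B a b * B a b
  have hq : be ^ 2 ≤ ff / w := by rw [le_div_iff₀ hw]; exact hcs
  have e1 : 13 / 12 * ff / w = 13 / 12 * (ff / w) := by ring
  have e2 : 2 * ff / w = 2 * (ff / w) := by ring
  have e3 : 12 * (n * w) / s = n * (12 * w / s) := by ring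
  rw [e1, e3] at hsum
  rw [e2] at hfr
  have main : w ^ 2 / 9 ≤ n * (12 * w / s) := by
    have hl := hfr (-(w + be) / (n - 1))
    have hn : (n : ℝ) = 2 ∨ (n : ℝ) = 3 ∨ (n : ℝ) = 4 := by
      have : n = 2 ∨ n = 3 ∨ n = 4 := by omega
      rcases this with h | h | h <;> simp [h]
    clear_value T ff be
    generalize (n : ℝ) = m at hl hsum hn ⊢
    generalize 12 * w / s = z at hsum ⊢
    rcases hn with rfl | rfl | rfl
    · norm_num at hl hsum ⊢
      nlinarith [sq_nonneg (w / 2 + be), sq_nonneg w, sq_nonneg be]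
    · norm_num at hl hsum ⊢
      nlinarith [sq_nonneg (w / 2 + be), sq_nonneg w, sq_nonneg be]
    · norm_num at hl hsum ⊢
      nlinarith [sq_nonneg (w / 3 - be / 2), sq_nonneg w, sq_nonneg be]
  have : w ^ 2 / 9 * (9 * s / w) ≤ n * (12 * w / s) * (9 * s / w) :=
    mul_le_mul_of_nonneg_right main (by positivity)
  field_simp at this
  linarith

lemma det_deriv {n : ℕ} (H : ℝ → Matrix (Fin n) (Fin n) ℝ) (H1 : Matrix (Fin n) (Fin n) ℝ) (t : ℝ)
    (h : ∀ i j, HasDerivAt (fun t => H t i j) (H1 i j) t) :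
    HasDerivAt (fun t => (H t).det) (((H t).adjugate * H1).trace) t := by
  have h1 : HasDerivAt (fun t => ∑ σ : Equiv.Perm (Fin n), ((Equiv.Perm.sign σ : ℤ) : ℝ) * ∏ i, H t (σ i) i)
      (∑ σ : Equiv.Perm (Fin n), ((Equiv.Perm.sign σ : ℤ) : ℝ) *
        ∑ i, (∏ j ∈ Finset.univ.erase i, H t (σ j) j) • H1 (σ i) i) t := by
    refine HasDerivAt.fun_sum fun σ _ => HasDerivAt.const_mul _ ?_
    exact HasDerivAt.fun_finsetProd fun i _ => h (σ i) i
  have e : (fun t => (H t).det) = (fun t => ∑ σ : Equiv.Perm (Fin n), ((Equiv.Perm.sign σ : ℤ) : ℝ) * ∏ i, H t (σ i) i) := by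
    funext t; rw [Matrix.det_apply']
  rw [e]
  refine h1.congr_deriv ?_
  have e2 : ((H t).adjugate * H1).trace = ∑ i, ((H t).updateCol i (fun j => H1 j i)).det := by
    rw [Matrix.trace]
    refine Finset.sum_congr rfl fun i _ => ?_
    rw [← Matrix.cramer_apply, Matrix.cramer_eq_adjugate_mulVec]
    rfl
  rw [e2]
  simp_rw [Matrix.det_apply', Finset.mul_sum]
  rw [Finset.sum_comm]
  refine Finset.sum_congr rfl fun i _ => Finset.sum_congr rfl fun σ _ => ?_
  congr 1
  rw [← Finset.prod_erase_mul _ _ (Finset.mem_univ i), smul_eq_mul]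
  congr 1
  · refine Finset.prod_congr rfl fun j hj => ?_
    rw [Matrix.updateCol_ne (Finset.ne_of_mem_erase hj)]
  · rw [Matrix.updateCol_self]

lemma logdet2 {n : ℕ} (H H1 : ℝ → Matrix (Fin n) (Fin n) ℝ) (H2 : Matrix (Fin n) (Fin n) ℝ)
    (hH : ∀ t i j, HasDerivAt (fun t => H t i j) (H1 t i j) t)
    (hH1 : ∀ i j, HasDerivAt (fun t => H1 t i j) (H2 i j) 0) (h0 : H 0 = 1)
    (κ : ℝ) (v v1 : ℝ → ℝ) (v2 : ℝ)
    (hv : ∀ t, HasDerivAt v (v1 t) t) (hv1 : HasDerivAt v1 v2 0)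
    (hdet : ∀ t, (H t).det = κ * Real.exp (- v t)) :
    ∑ a, H1 0 a a = - v1 0 ∧ ∑ a, H2 a a = ∑ a, ∑ b, H1 0 a b * H1 0 b a - v2 := by
  have hd : ∀ t, HasDerivAt (fun t => (H t).det) (((H t).adjugate * H1 t).trace) t :=
    fun t => det_deriv H (H1 t) t (hH t)
  have hd' : ∀ t, HasDerivAt (fun t => (H t).det) (- v1 t * (H t).det) t := by
    intro t
    have : HasDerivAt (fun t => κ * Real.exp (- v t)) (κ * (Real.exp (- v t) * (- v1 t))) t :=
      ((hv t).neg.exp).const_mul κ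
    have e : (fun t => (H t).det) = fun t => κ * Real.exp (- v t) := funext hdet
    rw [e, hdet]
    exact this.congr_deriv (by ring)
  have heq : ∀ t, ((H t).adjugate * H1 t).trace = - v1 t * (H t).det := fun t => (hd t).unique (hd' t)
  have htr : ∑ a, H1 0 a a = - v1 0 := by
    have := heq 0
    simpa [h0, Matrix.trace] using this
  refine ⟨htr, ?_⟩
  have hadj : ∀ i j, ∃ g, HasDerivAt (fun t => (H t).adjugate i j) g 0 := by
    intro i j
    simp_rw [Matrix.adjugate_apply]
    refine ⟨_, det_deriv (fun t => (H t).updateRow j (Pi.single i 1))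
      ((H1 0).updateRow j 0) 0 ?_⟩
    intro a b
    by_cases hab : a = j
    · subst hab
      simpa using hasDerivAt_const (0 : ℝ) ((Pi.single i (1 : ℝ) : Fin n → ℝ) b)
    · simpa [Matrix.updateRow_ne hab] using hH 0 a b
  choose G hG using hadj
  have hGval : ∀ i j, G i j = - v1 0 * (1 : Matrix (Fin n) (Fin n) ℝ) i j - H1 0 i j := by
    intro i j
    have a1 : HasDerivAt (fun t => ∑ k, (H t).adjugate i k * H t k j)
        (∑ k, (G i k * H 0 k j + (H 0).adjugate i k * H1 0 k j)) 0 :=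
      HasDerivAt.fun_sum fun k _ => (hG i k).mul (hH 0 k j)
    have a2 : HasDerivAt (fun t => ∑ k, (H t).adjugate i k * H t k j)
        (- v1 0 * (H 0).det * (1 : Matrix (Fin n) (Fin n) ℝ) i j) 0 := by
      have e : (fun t => ∑ k, (H t).adjugate i k * H t k j) =
          fun t => (H t).det * (1 : Matrix (Fin n) (Fin n) ℝ) i j := by
        funext t
        have := congrFun (congrFun (Matrix.adjugate_mul (H t)) i) j
        rw [Matrix.mul_apply] at this
        rw [this]; simp
      rw [e]
      exact (hd' 0).mul_const _
    have a3 := a1.unique a2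
    rw [h0, Finset.sum_add_distrib] at a3
    simp only [Matrix.adjugate_one, Matrix.det_one] at a3
    have b1 : ∑ k, G i k * (1 : Matrix (Fin n) (Fin n) ℝ) k j = G i j := by
      simp [Matrix.one_apply]
    have b2 : ∑ k, (1 : Matrix (Fin n) (Fin n) ℝ) i k * H1 0 k j = H1 0 i j := by
      simp [Matrix.one_apply]
    rw [b1, b2] at a3
    linarith
  have c1 : HasDerivAt (fun t => ((H t).adjugate * H1 t).trace)
      (∑ a, ∑ b, (G a b * H1 0 b a + (H 0).adjugate a b * H2 b a)) 0 := by
    have : HasDerivAt (fun t => ∑ a, ∑ b, (H t).adjugate a b * H1 t b a)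
      (∑ a, ∑ b, (G a b * H1 0 b a + (H 0).adjugate a b * H2 b a)) 0 :=
      HasDerivAt.fun_sum fun a _ => HasDerivAt.fun_sum fun b _ => (hG a b).mul (hH1 b a)
    exact this
  have c2 : HasDerivAt (fun t => ((H t).adjugate * H1 t).trace)
      (- v2 * (H 0).det + - v1 0 * (- v1 0 * (H 0).det)) 0 := by
    have e : (fun t => ((H t).adjugate * H1 t).trace) = fun t => - v1 t * (H t).det := funext heq
    rw [e]
    exact hv1.neg.mul (hd' 0)
  have c3 := c1.unique c2
  simp only [h0, hGval, Matrix.adjugate_one, Matrix.det_one] at c3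
  have c4 : ∑ a, ∑ b, ((- v1 0 * (1 : Matrix (Fin n) (Fin n) ℝ) a b - H1 0 a b) * H1 0 b a +
      (1 : Matrix (Fin n) (Fin n) ℝ) a b * H2 b a) =
      - v1 0 * ∑ a, H1 0 a a - ∑ a, ∑ b, H1 0 a b * H1 0 b a + ∑ a, H2 a a := by
    simp only [sub_mul, Finset.sum_add_distrib, Finset.sum_sub_distrib, mul_assoc, ← Finset.mul_sum]
    simp [Matrix.one_apply]
  rw [c4, htr] at c3
  linarith

open scoped MatrixOrder in
lemma exists_frame {n : ℕ} (A : Matrix (Fin n) (Fin n) ℝ) (h : A.PosDef) :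
    ∃ P : Matrix (Fin n) (Fin n) ℝ, P.transpose * A * P = 1 ∧ IsUnit P.det := by
  obtain ⟨S, hS⟩ := (CStarAlgebra.nonneg_iff_eq_star_mul_self).1 h.posSemidef.nonneg
  have hS' : A = S.transpose * S := by
    rw [hS, Matrix.star_eq_conjTranspose, Matrix.conjTranspose_eq_transpose_of_trivial]
  have hdet : IsUnit S.det := by
    have := h.det_pos
    rw [hS', Matrix.det_mul] at this
    refine isUnit_iff_ne_zero.2 fun h0 => ?_
    rw [h0] at this; simp at this
  refine ⟨S⁻¹, ?_, ?_⟩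
  · rw [hS', Matrix.transpose_nonsing_inv, ← Matrix.mul_assoc,
      Matrix.nonsing_inv_mul _ (by rwa [Matrix.det_transpose]), Matrix.one_mul,
      Matrix.mul_nonsing_inv _ hdet]
  · exact Matrix.isUnit_nonsing_inv_det _ hdet

/-- Directional derivative. -/
def dd {n : ℕ} (v : Fin n → ℝ) (f : (Fin n → ℝ) → ℝ) : (Fin n → ℝ) → ℝ :=
  fun x => fderiv ℝ f x v

/-- Smooth functions. -/
abbrev Smo {n : ℕ} (f : (Fin n → ℝ) → ℝ) : Prop := ContDiff ℝ (⊤ : ℕ∞) f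

lemma Smo.dd {n : ℕ} {f : (Fin n → ℝ) → ℝ} (hf : Smo f) (v : Fin n → ℝ) : Smo (dd v f) :=
  (hf.fderiv_right (m := (⊤ : ℕ∞)) (by simp)).clm_apply contDiff_const

lemma Smo.diff {n : ℕ} {f : (Fin n → ℝ) → ℝ} (hf : Smo f) : Differentiable ℝ f :=
  hf.differentiable (by simp)

lemma dd_comm {n : ℕ} {f : (Fin n → ℝ) → ℝ} (hf : Smo f) (v w : Fin n → ℝ) :
    dd v (dd w f) = dd w (dd v f) := by
  have hs : Differentiable ℝ (fderiv ℝ f) :=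
    (hf.fderiv_right (m := (⊤ : ℕ∞)) (by simp)).differentiable (by simp)
  have e : ∀ v w x, dd v (dd w f) x = fderiv ℝ (fderiv ℝ f) x v w := by
    intro v w x
    have : HasFDerivAt (fun y => fderiv ℝ f y w)
      ((ContinuousLinearMap.apply ℝ ℝ w).comp (fderiv ℝ (fderiv ℝ f) x)) x :=
      (ContinuousLinearMap.apply ℝ ℝ w).hasFDerivAt.comp x (hs x).hasFDerivAt
    unfold dd
    rw [this.fderiv]; rfl
  funext x
  rw [e, e]
  exact (hf.contDiffAt (x := x)).isSymmSndFDerivAt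
    (by rw [minSmoothness_of_isRCLikeNormedField]; exact WithTop.coe_le_coe.2 (le_top : (2 : ℕ∞) ≤ ⊤)) v w

lemma dd_line {n : ℕ} {f : (Fin n → ℝ) → ℝ} (hf : Smo f) (x v : Fin n → ℝ) (t : ℝ) :
    HasDerivAt (fun t : ℝ => f (x + t • v)) (dd v f (x + t • v)) t := by
  have h1 : HasDerivAt (fun t : ℝ => x + t • v) v t := by
    simpa using ((hasDerivAt_id t).smul_const v).const_add x
  exact (hf.diff (x + t • v)).hasFDerivAt.comp_hasDerivAt t h1

lemma dd_line0 {n : ℕ} {f : (Fin n → ℝ) → ℝ} (hf : Smo f) (x v : Fin n → ℝ) :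
    HasDerivAt (fun t : ℝ => f (x + t • v)) (dd v f x) 0 := by
  simpa using dd_line hf x v 0

lemma dd_sum {n m : ℕ} (f : (Fin n → ℝ) → ℝ) (c : Fin m → ℝ) (p : Fin m → Fin n → ℝ)
    (x : Fin n → ℝ) : dd (∑ a, c a • p a) f x = ∑ a, c a * dd (p a) f x := by
  simp [dd, map_sum]

lemma dd_sum2 {n m k : ℕ} {f : (Fin n → ℝ) → ℝ} (hf : Smo f) (c : Fin m → ℝ) (e : Fin k → ℝ)
    (p : Fin m → Fin n → ℝ) (q : Fin k → Fin n → ℝ) (x : Fin n → ℝ) :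
    dd (∑ a, c a • p a) (dd (∑ b, e b • q b) f) x = ∑ a, ∑ b, c a * e b * dd (p a) (dd (q b) f) x := by
  rw [dd_sum]
  refine Finset.sum_congr rfl fun a _ => ?_
  rw [dd_comm hf, dd_sum, Finset.mul_sum]
  refine Finset.sum_congr rfl fun b _ => ?_
  rw [dd_comm hf]; ring

lemma vec_eq {n : ℕ} (v : Fin n → ℝ) : v = ∑ i, v i • (Pi.single i (1 : ℝ) : Fin n → ℝ) := by
  funext j
  simp [Finset.sum_apply, Pi.single_apply]

lemma hess_dd {n : ℕ} {f : (Fin n → ℝ) → ℝ} (hf : Smo f) (v w x : Fin n → ℝ) :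
    dd v (dd w f) x = ∑ i, ∑ j, v i * w j * hess f x i j := by
  conv_lhs => rw [vec_eq v, vec_eq w]
  rw [dd_sum2 hf]
  rfl

lemma dd_pos {n : ℕ} {f : (Fin n → ℝ) → ℝ} (hf : Smo f) (hp : ∀ x, (hess f x).PosDef)
    (v x : Fin n → ℝ) (hv : v ≠ 0) : 0 < dd v (dd v f) x := by
  have := (hp x).dotProduct_mulVec_pos hv
  rw [hess_dd hf]
  refine this.trans_eq ?_
  simp only [dotProduct, Matrix.mulVec, Finset.mul_sum, Pi.star_apply, star_trivial]
  refine Finset.sum_congr rfl fun i _ => Finset.sum_congr rfl fun j _ => by ring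

lemma sublevel_compact {n : ℕ} {u : (Fin n → ℝ) → ℝ} (hu : Smo u) (hp : ∀ x, (hess u x).PosDef)
    (h0 : ∀ x, 0 ≤ u x) (hz : u 0 = 0) (C : ℝ) : IsCompact {x | u x ≤ C} := by
  have hconv : ∀ x : Fin n → ℝ, x ≠ 0 → StrictConvexOn ℝ Set.univ (fun t : ℝ => u (0 + t • x)) := by
    intro x hx
    have e1 : deriv (fun t : ℝ => u (0 + t • x)) = fun t => dd x u (0 + t • x) :=
      funext fun t => (dd_line hu 0 x t).deriv
    refine strictConvexOn_univ_of_deriv2_pos ?_ ?_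
    · exact continuous_iff_continuousAt.2 fun t => (dd_line hu 0 x t).continuousAt
    · intro t
      rw [Function.iterate_succ, Function.iterate_one, Function.comp, e1,
        (dd_line (hu.dd x) 0 x t).deriv]
      exact dd_pos hu hp _ _ hx
  have hpos : ∀ x : Fin n → ℝ, x ≠ 0 → 0 < u x := by
    intro x hx
    have := (hconv x hx).2 (Set.mem_univ 0) (Set.mem_univ 1) (by norm_num)
      (by norm_num : (0 : ℝ) < 1 / 2) (by norm_num : (0 : ℝ) < 1 / 2) (by norm_num)
    simp [hz] at this
    linarith [h0 ((2 : ℝ)⁻¹ • x)]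
  have hcont : Continuous u := hu.continuous
  refine Metric.isCompact_of_isClosed_isBounded (isClosed_le hcont continuous_const) ?_
  rcases (Metric.sphere (0 : Fin n → ℝ) 1).eq_empty_or_nonempty with hem | hne
  · refine (Metric.isBounded_closedBall (x := (0 : Fin n → ℝ)) (r := 0)).subset fun x _ => ?_
    by_contra hx
    have hx0 : x ≠ 0 := by rintro rfl; simp at hx
    have : (‖x‖⁻¹ • x) ∈ Metric.sphere (0 : Fin n → ℝ) 1 := by
      simp [norm_smul, hx0]
    rw [hem] at this; exact this
  obtain ⟨y, hy, hmin⟩ := (isCompact_sphere (0 : Fin n → ℝ) 1).exists_isMinOn hne hcont.continuousOn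
  have hy0 : y ≠ 0 := by rintro rfl; simp at hy
  have hm := hpos y hy0
  refine (Metric.isBounded_closedBall (x := (0 : Fin n → ℝ)) (r := max 1 (C / u y))).subset
    fun x hx => ?_
  rw [mem_closedBall_zero_iff]
  by_contra hlt
  push Not at hlt
  have h1 : 1 < ‖x‖ := lt_of_le_of_lt (le_max_left _ _) hlt
  have h2 : C / u y < ‖x‖ := lt_of_le_of_lt (le_max_right _ _) hlt
  have hx0 : x ≠ 0 := by rintro rfl; simp at h1; linarith
  have hmem : (‖x‖⁻¹ • x) ∈ Metric.sphere (0 : Fin n → ℝ) 1 := by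
    simp [norm_smul, hx0]
  have h3 : u y ≤ u (‖x‖⁻¹ • x) := hmin hmem
  have hinv : ‖x‖⁻¹ ≤ 1 := inv_le_one_of_one_le₀ h1.le
  have h4 := (hconv x hx0).convexOn.2 (Set.mem_univ 0) (Set.mem_univ 1)
      (by linarith : 0 ≤ 1 - ‖x‖⁻¹) (by positivity : 0 ≤ ‖x‖⁻¹) (by ring)
  simp [hz] at h4
  have h5 : u x ≤ C := hx
  rw [div_lt_iff₀ hm] at h2
  have h6 : ‖x‖ * u y ≤ u x := by
    have : ‖x‖ * u y ≤ ‖x‖ * (‖x‖⁻¹ * u x) := by gcongr; linarith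
    rwa [mul_inv_cancel_left₀ (by positivity)] at this
  linarith

lemma local_est {n : ℕ} (hn2 : 2 ≤ n) (hn4 : n ≤ 4) {u : (Fin n → ℝ) → ℝ} (hu : Smo u)
    (hp : ∀ x, (hess u x).PosDef) (d : Fin n → ℝ) (d0 : ℝ) (hd : d ≠ 0)
    (heq : ∀ ξ, (hess u ξ).det = Real.exp (-(∑ i : Fin n, d i * pd i u ξ) - d0))
    (C : ℝ) (x0 : Fin n → ℝ) (hC : u x0 < C)
    (hmax : IsLocalMax (fun x => dd d (dd d u) x * (C - u x) ^ 12) x0) :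
    dd d (dd d u) x0 * (C - u x0) ≤ 108 * n := by
  obtain ⟨P, hP, hPu⟩ := exists_frame _ (hp x0)
  set p : Fin n → Fin n → ℝ := fun a i => P i a with hpdef
  have hQ : ∀ x a b, (P.transpose * hess u x * P) a b = dd (p a) (dd (p b) u) x := by
    intro x a b
    rw [hess_dd hu, Matrix.mul_apply]
    simp only [Matrix.mul_apply, Matrix.transpose_apply, Finset.sum_mul]
    rw [Finset.sum_comm]
    refine Finset.sum_congr rfl fun i _ => Finset.sum_congr rfl fun j _ => ?_
    simp only [hpdef]; ring
  have hQ0 : ∀ a b, dd (p a) (dd (p b) u) x0 = (1 : Matrix (Fin n) (Fin n) ℝ) a b := by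
    intro a b; rw [← hQ, hP]
  set dl : Fin n → ℝ := P⁻¹.mulVec d with hdl
  have hd_dl : d = ∑ a, dl a • p a := by
    have h1 : P.mulVec dl = d := by
      rw [hdl, Matrix.mulVec_mulVec, Matrix.mul_nonsing_inv _ hPu, Matrix.one_mulVec]
    conv_lhs => rw [← h1]
    funext i
    simp [Matrix.mulVec, dotProduct, hpdef, mul_comm]
  have hdu : ∀ x, ∑ i, d i * pd i u x = dd d u x := by
    intro x
    conv_rhs => rw [vec_eq d, dd_sum]
    rfl
  have sQ : ∀ a b, Smo (dd (p a) (dd (p b) u)) := fun a b => (hu.dd _).dd _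
  have hlog := logdet2 (fun t => Matrix.of fun a b => dd (p a) (dd (p b) u) (x0 + t • d))
    (fun t => Matrix.of fun a b => dd d (dd (p a) (dd (p b) u)) (x0 + t • d))
    (Matrix.of fun a b => dd d (dd d (dd (p a) (dd (p b) u))) x0)
    (fun t a b => dd_line (sQ a b) x0 d t)
    (fun a b => dd_line0 ((sQ a b).dd d) x0 d)
    (by ext a b; simp [hQ0])
    (P.det * P.det * Real.exp (- d0))
    (fun t => dd d u (x0 + t • d)) (fun t => dd d (dd d u) (x0 + t • d))
    (dd d (dd d (dd d u)) x0) (fun t => dd_line (hu.dd d) x0 d t)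
    (dd_line0 ((hu.dd d).dd d) x0 d)
    (by
      intro t
      have : (Matrix.of fun a b => dd (p a) (dd (p b) u) (x0 + t • d)) =
          P.transpose * hess u (x0 + t • d) * P := by
        ext a b; rw [hQ]; rfl
      rw [this, Matrix.det_mul, Matrix.det_mul, Matrix.det_transpose, heq, hdu,
        sub_eq_add_neg, Real.exp_add]
      ring)
  simp only [Matrix.of_apply, zero_smul, add_zero] at hlog
  obtain ⟨htr, hH2⟩ := hlog
  have hw := dd_pos hu hp d x0 hd
  have hBsymm : ∀ a b, dd d (dd (p a) (dd (p b) u)) x0 = dd d (dd (p b) (dd (p a) u)) x0 := by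
    intro a b; rw [dd_comm hu (p a) (p b)]
  have hwd : ∑ a, dl a * dl a = dd d (dd d u) x0 := by
    conv_rhs => rw [hd_dl]
    rw [dd_sum2 hu]
    simp [hQ0, Matrix.one_apply]
  have hf : ∀ a, dd (p a) (dd d (dd d u)) x0 = ∑ b, dd d (dd (p a) (dd (p b) u)) x0 * dl b := by
    intro a
    rw [dd_comm (hu.dd d) (p a) d, dd_comm hu (p a) d]
    have : ∀ g, dd d g x0 = ∑ b, dl b * dd (p b) g x0 := by
      intro g
      conv_lhs => rw [hd_dl, dd_sum]
    rw [this]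
    refine Finset.sum_congr rfl fun b _ => ?_
    rw [dd_comm (hu.dd (p a)) (p b) d, dd_comm hu (p b) (p a)]; ring
  have hdf : ∑ a, dl a * dd (p a) (dd d (dd d u)) x0 = dd d (dd d (dd d u)) x0 := by
    rw [← dd_sum, ← hd_dl]
  have hW2 : ∀ a, dd (p a) (dd (p a) (dd d (dd d u))) x0 =
      dd d (dd d (dd (p a) (dd (p a) u))) x0 := by
    intro a
    rw [dd_comm (hu.dd d) (p a) d, dd_comm hu (p a) d, dd_comm ((hu.dd _).dd _) (p a) d,
      dd_comm (hu.dd _) (p a) d]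
  have hst : ∀ a, _ := fun a => second_test (fun t => dd d (dd d u) (x0 + t • p a))
    (fun t => dd (p a) (dd d (dd d u)) (x0 + t • p a))
    (fun t => u (x0 + t • p a)) (fun t => dd (p a) u (x0 + t • p a))
    (dd (p a) (dd (p a) (dd d (dd d u))) x0) (dd (p a) (dd (p a) u) x0) C
    (fun t => dd_line ((hu.dd d).dd d) x0 (p a) t)
    (dd_line0 (((hu.dd d).dd d).dd (p a)) x0 (p a))
    (fun t => dd_line hu x0 (p a) t) (dd_line0 (hu.dd (p a)) x0 (p a)) (by simpa using hC)
    (by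
      have hc : Filter.Tendsto (fun t : ℝ => x0 + t • p a) (nhds 0) (nhds x0) := by
        have : Continuous (fun t : ℝ => x0 + t • p a) := by fun_prop
        simpa using this.tendsto 0
      have := hc.eventually hmax
      filter_upwards [this] with t ht
      simpa using ht)
  simp only [zero_smul, add_zero] at hst
  refine algebra_core hn2 hn4 (fun a b => dd d (dd (p a) (dd (p b) u)) x0) dl
    (fun a => dd (p a) (dd d (dd d u)) x0) (fun a => dd (p a) u x0)
    (fun a => dd (p a) (dd (p a) (dd d (dd d u))) x0) hBsymm _ _ hw (sub_pos.2 hC) hwd hf htr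
    (fun a => (hst a).1) ?_ ?_
  · simp only [hW2, hdf]
    rw [hH2]
    congr 1
    refine Finset.sum_congr rfl fun a _ => Finset.sum_congr rfl fun b _ => ?_
    rw [hBsymm b a]
  · intro a
    have := (hst a).2
    rw [hQ0 a a, Matrix.one_apply_eq] at this
    exact this

lemma d_zero {n : ℕ} (hn2 : 2 ≤ n) (hn4 : n ≤ 4) {u : (Fin n → ℝ) → ℝ} (hu : Smo u)
    (hp : ∀ x, (hess u x).PosDef) (d : Fin n → ℝ) (d0 : ℝ)
    (heq : ∀ ξ, (hess u ξ).det = Real.exp (-(∑ i : Fin n, d i * pd i u ξ) - d0))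
    (h0 : ∀ x, 0 ≤ u x) (hz : u 0 = 0) : d = 0 := by
  by_contra hd
  have hw0 := dd_pos hu hp d 0 hd
  have bound : ∀ C : ℝ, 0 < C → dd d (dd d u) 0 * C ≤ 108 * n := by
    intro C hC
    have hcont : Continuous (fun x => dd d (dd d u) x * (C - u x) ^ 12) :=
      ((hu.dd d).dd d).continuous.mul ((continuous_const.sub hu.continuous).pow 12)
    obtain ⟨x0, hx0, hmax⟩ := (sublevel_compact hu hp h0 hz C).exists_isMaxOn
      ⟨0, by simp [hz, hC.le]⟩ hcont.continuousOn
    have hge : dd d (dd d u) 0 * C ^ 12 ≤ dd d (dd d u) x0 * (C - u x0) ^ 12 := by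
      have := hmax (show (0 : Fin n → ℝ) ∈ {x | u x ≤ C} by simp [hz, hC.le])
      simpa [hz] using this
    have hx0' : u x0 ≤ C := hx0
    have hlt : u x0 < C := by
      rcases hx0'.lt_or_eq with h | h
      · exact h
      · rw [h] at hge
        have : 0 < dd d (dd d u) 0 * C ^ 12 := by positivity
        simp at hge
        linarith
    have hloc : IsLocalMax (fun x => dd d (dd d u) x * (C - u x) ^ 12) x0 := by
      refine hmax.isLocalMax ?_
      exact Filter.mem_of_superset
        ((isOpen_lt hu.continuous continuous_const).mem_nhds hlt) (fun x (hx : u x < C) => show u x ≤ C from hx.le)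
    have hest := local_est hn2 hn4 hu hp d d0 hd heq C x0 hlt hloc
    have hs : 0 < C - u x0 := sub_pos.2 hlt
    have hsC : C - u x0 ≤ C := by linarith [h0 x0]
    have h11 : (C - u x0) ^ 11 ≤ C ^ 11 := by gcongr
    have : C ^ 11 * (dd d (dd d u) 0 * C) ≤ C ^ 11 * (108 * n) := by
      calc C ^ 11 * (dd d (dd d u) 0 * C) = dd d (dd d u) 0 * C ^ 12 := by ring
        _ ≤ dd d (dd d u) x0 * (C - u x0) ^ 12 := hge
        _ = (C - u x0) ^ 11 * (dd d (dd d u) x0 * (C - u x0)) := by ring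
        _ ≤ (C - u x0) ^ 11 * (108 * n) := by gcongr
        _ ≤ C ^ 11 * (108 * n) := by gcongr
    exact le_of_mul_le_mul_left this (by positivity)
  have := bound ((108 * n + 1) / dd d (dd d u) 0) (by positivity)
  rw [mul_div_cancel₀ _ hw0.ne'] at this
  linarith

/-- For `2 ≤ n ≤ 4`, there is a constant `b > 0` depending only on `n` such
that for every normalized smooth strictly convex global solution `u` of
equation (1.4), every `C > 0` and every `ξ` with `u(ξ) < C`, one has
`exp(−8(n−1)C/(C−u(ξ))) Φ(ξ) ≤ b/C`; letting `C → ∞` gives `Φ ≡ 0`. -/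
theorem Phi_estimate_low_dimensions (n : ℕ) (hn2 : 2 ≤ n) (hn4 : n ≤ 4) :
    ∃ b : ℝ, 0 < b ∧
      ∀ (u : (Fin n → ℝ) → ℝ), ContDiff ℝ (⊤ : ℕ∞) u →
        (∀ x : Fin n → ℝ, (hess u x).PosDef) →
        ∀ (d : Fin n → ℝ) (d0 : ℝ),
          (∀ ξ : Fin n → ℝ,
            (hess u ξ).det = Real.exp (-(∑ i : Fin n, d i * pd i u ξ) - d0)) →
          (∀ ξ : Fin n → ℝ, 0 ≤ u ξ) → u 0 = 0 →
          (∀ C : ℝ, 0 < C → ∀ ξ : Fin n → ℝ, u ξ < C →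
              Real.exp (-(8 * ((n : ℝ) - 1) * C) / (C - u ξ)) * PhiU u ξ ≤ b / C) ∧
            (∀ ξ : Fin n → ℝ, PhiU u ξ = 0) := by
  refine ⟨1, one_pos, ?_⟩
  intro u hu hp d d0 heq h0 hz
  have hd : d = 0 := d_zero hn2 hn4 hu hp d d0 heq h0 hz
  have hPhi : ∀ ξ : Fin n → ℝ, PhiU u ξ = 0 := by
    intro ξ
    have hr : rhoU u = fun _ => Real.exp (- d0) ^ ((1 : ℝ) / (n + 2)) := by
      funext x
      simp [rhoU, heq, hd]
    have hpd : ∀ i, pd i (rhoU u) ξ = 0 := by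
      intro i
      rw [hr]
      simp [pd]
    simp [PhiU, hpd]
  refine ⟨fun C hC ξ _ => ?_, hPhi⟩
  rw [hPhi ξ, mul_zero]
  positivity
end
end
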